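/- Let p be a fixed point of J, let q be the next fixed point after p (i.e., q is a fixed point, q > p, and there is no fixed point strictly between p and q), and let m̄ ≥ 1 be the 2-adic valuation of 3·p + 2. For each j with 1 ≤ j ≤ m̄, the number e_j := 3^{j−1}·(3·p + 2)/2^{j} − 1 is a pure high extremal point of J (i.e., J(e_j) = e_j − 1, and in particular 2^j divides 3^{j−1}·(3·p + 2)); moreover, every high extremal point k with p < k < q equals e_j for some j with 1 ≤ j ≤ m̄. -/

import Mathlib

/-- The Josephus function with reduction constant 3:
`J 1 = 1` and `J n = ((J (n-1) + 2) % n) + 1` for `n ≥ 2`. -/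
def J : ℕ → ℕ
  | 0 => 0
  | 1 => 1
  | n + 2 => (J (n + 1) + 2) % (n + 2) + 1

/-- `n ≥ 1` is a high extremal point if `J n ∈ {n-1, n}`. -/
def IsHighExtremal (n : ℕ) : Prop := 1 ≤ n ∧ (J n = n - 1 ∨ J n = n)

theorem J_succ {n : ℕ} (hn : 1 ≤ n) : J (n + 1) = (J n + 2) % (n + 1) + 1 := by
  obtain ⟨m, rfl⟩ : ∃ m, n = m + 1 := ⟨n - 1, by omega⟩
  rfl

/-- As long as no wrap-around occurs, `J` grows by `3` at each step. -/
theorem J_add_of_le {n a : ℕ} (ha : J n = a) (i : ℕ) (hi : a + 3 * i ≤ n + i) :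
    J (n + i) = a + 3 * i := by
  induction i with
  | zero => simpa using ha
  | succ i ih =>
    rw [← add_assoc, J_succ (by omega), ih (by omega), Nat.mod_eq_of_lt (by omega)]
    omega

theorem J_succ_of_eq_self {n : ℕ} (hn : 1 ≤ n) (h : J n = n) : J (n + 1) = 2 := by
  rw [J_succ hn, h, Nat.mod_eq_sub_mod (by omega), Nat.mod_eq_of_lt (by omega)]
  omega

theorem J_succ_of_eq_pred {n : ℕ} (hn : 1 ≤ n) (h : J n = n - 1) : J (n + 1) = 1 := by
  rw [J_succ hn, h, show n - 1 + 2 = n + 1 by omega, Nat.mod_self]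

theorem not_isHighExtremal_of_lt {n a k : ℕ} (ha : J n = a) (hk : n ≤ k)
    (hlt : a + 2 * (k - n) + 1 < n) : ¬ IsHighExtremal k := by
  have h := J_add_of_le ha (k - n) (by omega)
  rw [Nat.add_sub_cancel' hk] at h
  rintro ⟨-, h' | h'⟩ <;> omega

/-- After an even fixed point `2 * t`, the next high extremal point is the pure one `3 * t`. -/
theorem next_of_even_fixed {t : ℕ} (ht : 1 ≤ t) (h : J (2 * t) = 2 * t) :
    J (3 * t) = 3 * t - 1 ∧ ∀ k, 2 * t < k → k < 3 * t → ¬ IsHighExtremal k := by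
  have h1 := J_succ_of_eq_self (by omega) h
  refine ⟨?_, fun k hk hk' => not_isHighExtremal_of_lt h1 hk (by omega)⟩
  have h2 := J_add_of_le h1 (t - 1) (by omega)
  rw [show 2 * t + 1 + (t - 1) = 3 * t by omega] at h2
  omega

/-- After an odd pure high extremal point `2 * y - 1`, the next high extremal point is the pure
one `3 * y - 1`. -/
theorem next_of_odd_pure {y : ℕ} (hy : 1 ≤ y) (h : J (2 * y - 1) = 2 * y - 1 - 1) :
    J (3 * y - 1) = 3 * y - 1 - 1 ∧
      ∀ k, 2 * y - 1 < k → k < 3 * y - 1 → ¬ IsHighExtremal k := by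
  have h1 := J_succ_of_eq_pred (by omega) h
  refine ⟨?_, fun k hk hk' => not_isHighExtremal_of_lt h1 hk (by omega)⟩
  have h2 := J_add_of_le h1 (y - 1) (by omega)
  rw [show 2 * y - 1 + 1 + (y - 1) = 3 * y - 1 by omega] at h2
  omega

/-- After an even pure high extremal point `2 * t`, the next high extremal point is the fixed
point `3 * t + 1`. -/
theorem next_of_even_pure {t : ℕ} (ht : 1 ≤ t) (h : J (2 * t) = 2 * t - 1) :
    J (3 * t + 1) = 3 * t + 1 ∧ ∀ k, 2 * t < k → k < 3 * t + 1 → ¬ IsHighExtremal k := by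
  have h1 := J_succ_of_eq_pred (by omega) h
  refine ⟨?_, fun k hk hk' => not_isHighExtremal_of_lt h1 hk (by omega)⟩
  have h2 := J_add_of_le h1 t (by omega)
  rw [show 2 * t + 1 + t = 3 * t + 1 by omega] at h2
  omega

theorem stmt_12 (p q : ℕ) (hp1 : 1 ≤ p) (hp : J p = p)
    (hq : J q = q) (hlt : p < q)
    (hnext : ∀ k, p < k → k < q → J k ≠ k)
    (mbar : ℕ) (hmbar : mbar = padicValNat 2 (3 * p + 2)) (hm1 : 1 ≤ mbar) :
    (∀ j, 1 ≤ j → j ≤ mbar →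
        2 ^ j ∣ 3 ^ (j - 1) * (3 * p + 2) ∧
        J (3 ^ (j - 1) * (3 * p + 2) / 2 ^ j - 1) =
          (3 ^ (j - 1) * (3 * p + 2) / 2 ^ j - 1) - 1) ∧
    (∀ k, p < k → k < q → IsHighExtremal k →
        ∃ j, 1 ≤ j ∧ j ≤ mbar ∧ k = 3 ^ (j - 1) * (3 * p + 2) / 2 ^ j - 1) := by
  obtain ⟨r, hr⟩ : 2 ^ mbar ∣ 3 * p + 2 := hmbar ▸ pow_padicValNat_dvd
  have hr_odd : r % 2 = 1 := by
    by_contra hne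
    have hdvd : 2 ^ (padicValNat 2 (3 * p + 2) + 1) ∣ 3 * p + 2 := by
      rw [← hmbar, pow_succ]
      conv_rhs => rw [hr]
      exact mul_dvd_mul_left _ (by omega)
    exact pow_succ_padicValNat_not_dvd (by omega) hdvd
  have hr_pos : 0 < r := by omega
  have hmul : ∀ j, j ≤ mbar →
      3 ^ (j - 1) * (3 * p + 2) = 2 ^ j * (3 ^ (j - 1) * 2 ^ (mbar - j) * r) := by
    intro j hj
    rw [hr, ← Nat.add_sub_cancel' hj, pow_add, Nat.add_sub_cancel' hj]
    ring
  have hquot : ∀ j, j ≤ mbar →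
      3 ^ (j - 1) * (3 * p + 2) / 2 ^ j = 3 ^ (j - 1) * 2 ^ (mbar - j) * r := by
    intro j hj
    rw [hmul j hj, Nat.mul_div_cancel_left _ (by positivity)]
  have key : ∀ j, 1 ≤ j → j ≤ mbar →
      p < 3 ^ (j - 1) * (3 * p + 2) / 2 ^ j - 1 ∧
      J (3 ^ (j - 1) * (3 * p + 2) / 2 ^ j - 1) =
          (3 ^ (j - 1) * (3 * p + 2) / 2 ^ j - 1) - 1 ∧
      ∀ k, p < k → k ≤ 3 ^ (j - 1) * (3 * p + 2) / 2 ^ j - 1 → IsHighExtremal k →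
        ∃ i, 1 ≤ i ∧ i ≤ mbar ∧ k = 3 ^ (i - 1) * (3 * p + 2) / 2 ^ i - 1 := by
    intro j hj
    induction j, hj using Nat.le_induction with
    | base =>
      intro hle
      have h1 := hmul 1 hle
      obtain ⟨t, rfl⟩ : ∃ t, p = 2 * t := ⟨p / 2, by omega⟩
      obtain ⟨hJ, hnone⟩ := next_of_even_fixed (by omega) hp
      have he : 3 ^ (1 - 1) * (3 * (2 * t) + 2) / 2 ^ 1 - 1 = 3 * t := by omega
      refine ⟨by omega, by rwa [he], fun k hk hk' hhigh => ⟨1, le_rfl, hle, ?_⟩⟩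
      by_contra hne
      exact hnone k hk (by omega) hhigh
    | succ j hj ih =>
      intro hle
      obtain ⟨hlt_e, hJ, hall⟩ := ih (by omega)
      obtain ⟨y, hy⟩ : ∃ y, y = 3 ^ (j - 1) * 2 ^ (mbar - (j + 1)) * r := ⟨_, rfl⟩
      have hy_pos : 1 ≤ y := by rw [hy]; exact Nat.succ_le_of_lt (by positivity)
      have hcur : 3 ^ (j - 1) * (3 * p + 2) / 2 ^ j = 2 * y := by
        rw [hquot j (by omega), hy, show mbar - j = mbar - (j + 1) + 1 by omega, pow_succ]
        ring
      have hnxt : 3 ^ (j + 1 - 1) * (3 * p + 2) / 2 ^ (j + 1) = 3 * y := by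
        rw [hquot (j + 1) hle, hy, show j + 1 - 1 = j - 1 + 1 by omega, pow_succ]
        ring
      rw [hcur] at hlt_e hJ hall
      obtain ⟨hJ', hnone⟩ := next_of_odd_pure hy_pos hJ
      refine ⟨by omega, by rwa [hnxt], fun k hk hk' hhigh => ?_⟩
      rcases le_or_gt k (2 * y - 1) with hky | hky
      · exact hall k hk hky hhigh
      · refine ⟨j + 1, by omega, hle, ?_⟩
        by_contra hne
        exact hnone k hky (by omega) hhigh
  refine ⟨fun j hj hle => ⟨⟨_, hmul j hle⟩, (key j hj hle).2.1⟩, fun k hk hkq hhigh => ?_⟩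
  obtain ⟨hlt_e, hJ, hall⟩ := key mbar hm1 le_rfl
  rcases le_or_gt k (3 ^ (mbar - 1) * (3 * p + 2) / 2 ^ mbar - 1) with hle | hgt
  · exact hall k hk hle hhigh
  have hlast := hquot mbar le_rfl
  rw [Nat.sub_self, pow_zero, mul_one] at hlast
  have hodd : (3 ^ (mbar - 1) * r) % 2 = 1 := by
    rw [← Nat.odd_iff] at hr_odd ⊢
    exact ((by decide : Odd 3).pow).mul hr_odd
  rw [hlast] at hlt_e hJ hgt
  obtain ⟨t, ht⟩ : ∃ t, 3 ^ (mbar - 1) * r = 2 * t + 1 := ⟨3 ^ (mbar - 1) * r / 2, by omega⟩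
  rw [ht, Nat.add_sub_cancel] at hlt_e hJ hgt
  obtain ⟨hfix, hnone⟩ := next_of_even_pure (by omega) hJ
  have hqle : q ≤ 3 * t + 1 := by
    by_contra! hlt'
    exact hnext _ (by omega) hlt' hfix
  exact absurd hhigh (hnone k hgt (by omega))
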